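/- arXiv:2307.10332 — 2 statements merged into one kernel-verified Lean document; each statement's English description precedes it below -/
import Mathlib

section
/- Let (G,W,S,⪯,s) be a POSP instance that is well-posed, history-free, weakly independent and cycle-non-decreasing. Then the instance is weakly subpath optimal. -/
/-- A path in the digraph with arc relation `A`: a nonempty list of vertices in which
consecutive vertices are joined by arcs. -/
def IsPath {V : Type*} (A : V → V → Prop) (p : List V) : Prop :=
  p ≠ [] ∧ p.Chain' A

/-- An `s,t`-path: a path starting at `s` and ending at `t`. -/
def IsStPath {V : Type*} (A : V → V → Prop) (s t : V) (p : List V) : Prop :=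
  IsPath A p ∧ p.head? = some s ∧ p.getLast? = some t

/-- An efficient `s,t`-path: an `s,t`-path such that no `s,t`-path has strictly
smaller weight (`W q < W p` iff `W q ⪯ W p` and `W q ≠ W p` in a partial order). -/
def EfficientPath {V S : Type*} [PartialOrder S] (A : V → V → Prop) (s : V)
    (W : List V → S) (t : V) (p : List V) : Prop :=
  IsStPath A s t p ∧ ∀ q : List V, IsStPath A s t q → ¬ W q < W p

/-- History-freeness: extensions of equal-weight `s,v`-paths along the same arc out
of `v` have equal weight. -/
def HistoryFree {V S : Type*} (A : V → V → Prop) (s : V) (W : List V → S) : Prop :=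
  ∀ v u : V, A v u → ∀ p q : List V, IsStPath A s v p → IsStPath A s v q →
    W p = W q → W (p ++ [u]) = W (q ++ [u])

/-- Weak independence: `W p ≺ W q` implies `W (p+a) ⪯ W (q+a)` for arcs `a` out of
the common endpoint. -/
def WeaklyIndependent {V S : Type*} [PartialOrder S] (A : V → V → Prop) (s : V)
    (W : List V → S) : Prop :=
  ∀ v u : V, A v u → ∀ p q : List V, IsStPath A s v p → IsStPath A s v q →
    W p < W q → W (p ++ [u]) ≤ W (q ++ [u])

/-- Cycle-non-decreasing: appending a cycle never strictly decreases the weight. -/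
def CycleNonDecreasing {V S : Type*} [PartialOrder S] (A : V → V → Prop) (s : V)
    (W : List V → S) : Prop :=
  ∀ v : V, ∀ p c : List V, IsStPath A s v p → IsStPath A v v c → 2 ≤ c.length →
    ¬ W (p ++ c.tail) < W p

/-- The nondominated set `N_{s,t}`: weights of efficient `s,t`-paths. -/
def NondomSet {V S : Type*} [PartialOrder S] (A : V → V → Prop) (s : V)
    (W : List V → S) (t : V) : Set S :=
  {τ | ∃ p : List V, EfficientPath A s W t p ∧ W p = τ}

/-- Well-posedness: the set of all nondominated weights is finite, and every
nonempty chain of path weights contains a minimum element. -/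
def WellPosed {V S : Type*} [PartialOrder S] (A : V → V → Prop) (s : V)
    (W : List V → S) : Prop :=
  (⋃ v : V, NondomSet A s W v).Finite ∧
  ∀ C : Set S,
    C ⊆ {τ | ∃ p : List V, IsPath A p ∧ p.head? = some s ∧ W p = τ} →
    IsChain (· ≤ ·) C → C.Nonempty → ∃ m ∈ C, ∀ x ∈ C, m ≤ x

/-- A path `p = (v₁,…,vₙ)` is subpath optimal if every prefix `(v₁,…,vᵢ)` is an
efficient `s,vᵢ`-path. -/
def SubpathOptimalPath {V S : Type*} [PartialOrder S] (A : V → V → Prop) (s : V)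
    (W : List V → S) (p : List V) : Prop :=
  ∀ (i : ℕ) (h : i < p.length), EfficientPath A s W (p[i]'h) (p.take (i + 1))

/-- Weak subpath optimality of the instance: every efficient `s,t`-path has an
equal-weight `s,t`-path all of whose prefixes are efficient. -/
def WeaklySubpathOptimal {V S : Type*} [PartialOrder S] (A : V → V → Prop) (s : V)
    (W : List V → S) : Prop :=
  ∀ (t : V) (p : List V), EfficientPath A s W t p →
    ∃ q : List V, IsStPath A s t q ∧ W q = W p ∧ SubpathOptimalPath A s W q

section Paths

variable {V S : Type*} {A : V → V → Prop} {s t u v : V} {p q r : List V}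

theorem isStPath_singleton (v : V) : IsStPath A v v [v] :=
  ⟨⟨by simp, List.isChain_singleton v⟩, rfl, rfl⟩

theorem IsStPath.append (hp : IsStPath A s v p) (hr : IsStPath A v t (v :: r)) :
    IsStPath A s t (p ++ r) := by
  obtain ⟨⟨hp0, hpc⟩, hps, hpv⟩ := hp
  obtain ⟨⟨-, hrc⟩, -, hrt⟩ := hr
  refine ⟨⟨by simp [hp0], ?_⟩, ?_, ?_⟩
  · have hrc := List.isChain_cons.1 hrc
    refine List.isChain_append.2 ⟨hpc, hrc.2, ?_⟩
    intro x hx y hy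
    rw [hpv] at hx
    cases hx
    exact hrc.1 y hy
  · simp [List.head?_append, hps]
  · cases r with
    | nil => simpa using hpv.trans (by simpa using hrt)
    | cons a l => simpa [List.getLast?_append, List.getLast?_cons_cons] using hrt

theorem IsStPath.of_append (h : IsStPath A s t (p ++ r)) (hp : IsStPath A s v p) :
    IsStPath A v t (v :: r) := by
  obtain ⟨⟨-, hc⟩, -, ht⟩ := h
  obtain ⟨hpc, hrc, hpr⟩ := List.isChain_append.1 hc
  refine ⟨⟨by simp, ?_⟩, rfl, ?_⟩
  · exact List.isChain_cons.2 ⟨fun y hy => hpr v hp.2.2 y hy, hrc⟩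
  · cases r with
    | nil => simpa [hp.2.2] using ht
    | cons a l => simpa [List.getLast?_append, List.getLast?_cons_cons] using ht

theorem IsStPath.exists_of_append (h : IsStPath A s t (p ++ r)) (hp : p ≠ []) :
    ∃ v, IsStPath A s v p := by
  refine ⟨p.getLast hp, ⟨hp, (List.isChain_append.1 h.1.2).1⟩, ?_,
    List.getLast?_eq_some_getLast hp⟩
  simpa [List.head?_append_of_ne_nil p hp] using h.2.1

theorem IsStPath.eq_of_concat (h : IsStPath A s t (p ++ [u])) : t = u := by
  simpa using h.2.2.symm

theorem IsStPath.adj_of_concat (h : IsStPath A s t (p ++ [u])) (hp : IsStPath A s v p) :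
    A v u :=
  (List.isChain_append.1 h.1.2).2.2 v hp.2.2 u rfl

theorem IsStPath.concat (hp : IsStPath A s v p) (h : A v u) : IsStPath A s u (p ++ [u]) :=
  hp.append ⟨⟨by simp, List.isChain_pair.2 h⟩, rfl, rfl⟩

variable [PartialOrder S] {W : List V → S}

theorem EfficientPath.of_weight_eq (hp : EfficientPath A s W t p) (hq : IsStPath A s t q)
    (h : W q = W p) : EfficientPath A s W t q :=
  ⟨hq, fun q' hq' => h ▸ hp.2 q' hq'⟩

theorem efficientPath_singleton (hCND : CycleNonDecreasing A s W) :
    EfficientPath A s W s [s] := by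
  refine ⟨isStPath_singleton s, fun q hq hlt => ?_⟩
  obtain ⟨a, l, rfl⟩ := List.exists_cons_of_ne_nil hq.1.1
  obtain rfl : a = s := by simpa using hq.2.1
  cases l with
  | nil => exact hlt.false
  | cons b l => exact hCND a [a] (a :: b :: l) (isStPath_singleton a) hq (by simp) hlt

theorem SubpathOptimalPath.concat (hp : SubpathOptimalPath A s W p)
    (h : EfficientPath A s W u (p ++ [u])) : SubpathOptimalPath A s W (p ++ [u]) := by
  intro i hi
  by_cases hip : i < p.length
  · simpa [List.getElem_append_left hip, List.take_append_of_le_length hip] using hp i hip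
  · obtain rfl : i = p.length := by simp at hi; omega
    simpa [List.take_of_length_le] using h

theorem WellPosed.exists_efficientPath_le (hWP : WellPosed A s W) (hp : IsStPath A s t p) :
    ∃ q, EfficientPath A s W t q ∧ W q ≤ W p := by
  obtain ⟨m, hmp, ⟨q, hq, hqm⟩, hmax⟩ :=
    zorn_le_nonempty₀ {τ : Sᵒᵈ | ∃ q, IsStPath A s t q ∧ W q = OrderDual.ofDual τ}
      (fun C hC hchain y hy => by
        obtain ⟨m, hm, hle⟩ := hWP.2 (OrderDual.toDual ⁻¹' C)
          (fun τ hτ => by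
            obtain ⟨q, hq, h⟩ := hC hτ
            exact ⟨q, hq.1, hq.2.1, h⟩)
          (fun a ha b hb hab => (hchain ha hb hab).symm) ⟨_, hy⟩
        exact ⟨OrderDual.toDual m, hC hm, fun z hz => hle (OrderDual.ofDual z) hz⟩)
      (OrderDual.toDual (W p)) ⟨p, hp, rfl⟩
  refine ⟨q, ⟨hq, fun q' hq' hlt => ?_⟩, hqm ▸ hmp⟩
  rw [hqm] at hlt
  exact hlt.not_ge (hmax (y := OrderDual.toDual (W q')) ⟨q', hq', rfl⟩ hlt.le)

/-- A path either has only efficient prefixes or splits after its longest inefficient prefix. -/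
theorem IsStPath.subpathOptimal_or_exists_split (hs : EfficientPath A s W s [s]) :
    ∀ {t : V}, IsStPath A s t p → SubpathOptimalPath A s W p ∨
      ∃ q r v, p = q ++ r ∧ IsStPath A s v q ∧ ¬ EfficientPath A s W v q ∧
        ∀ l, l ≠ [] → l <+: r → ∃ u, EfficientPath A s W u (q ++ l) := by
  induction p using List.reverseRecOn with
  | nil => exact fun h => absurd rfl h.1.1
  | append_singleton p u ih =>
    intro t h
    obtain rfl := h.eq_of_concat
    by_cases he : EfficientPath A s W t (p ++ [t])
    · by_cases hp : p = []
      · subst hp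
        obtain rfl : t = s := by simpa using h.2.1
        left
        intro i hi
        obtain rfl : i = 0 := by simpa using hi
        simpa using hs
      · obtain ⟨v, hv⟩ := h.exists_of_append hp
        rcases ih hv with h' | ⟨q, r, w, rfl, hq, hne, hr⟩
        · exact .inl (h'.concat he)
        · refine .inr ⟨q, r ++ [t], w, by simp, hq, hne, fun l hl hlr => ?_⟩
          rcases List.prefix_concat_iff.1 hlr with rfl | hlr
          · exact ⟨t, by simpa using he⟩
          · exact hr l hl hlr
    · exact .inr ⟨p ++ [t], [], t, by simp, h, he,
        fun l hl hlr => absurd (List.prefix_nil.1 hlr) hl⟩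

theorem weight_append_eq_of_lt (hHF : HistoryFree A s W) (hWI : WeaklyIndependent A s W)
    (hp : IsStPath A s v p) (hq : IsStPath A s v q) (hqp : W q < W p)
    (hr : ∀ l, l ≠ [] → l <+: r → ∃ u, EfficientPath A s W u (p ++ l)) :
    (r ≠ [] → W (q ++ r) = W (p ++ r)) ∧
      (SubpathOptimalPath A s W q → SubpathOptimalPath A s W (q ++ r)) := by
  induction r using List.reverseRecOn with
  | nil => simp
  | append_singleton r u ih =>
    obtain ⟨ihW, ihS⟩ := ih fun l hl hlr => hr l hl (hlr.trans (List.prefix_append _ _))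
    obtain ⟨t, ht⟩ := hr (r ++ [u]) (by simp) List.prefix_rfl
    rw [← List.append_assoc] at ht ⊢
    rw [← List.append_assoc]
    obtain rfl := ht.1.eq_of_concat
    obtain ⟨w, hw⟩ := ht.1.exists_of_append (by simp [hp.1.1])
    have hadj := ht.1.adj_of_concat hw
    have hqr : IsStPath A s w (q ++ r) := hq.append (hw.of_append hp)
    have hqt := hqr.concat hadj
    have hW : W (q ++ r ++ [t]) = W (p ++ r ++ [t]) := by
      by_cases h0 : r = []
      · subst h0
        simp only [List.append_nil] at *
        exact (hWI _ _ hadj _ _ hqr hw hqp).eq_of_not_lt (ht.2 _ hqt)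
      · exact hHF _ _ hadj _ _ hqr hw (ihW h0)
    exact ⟨fun _ => hW, fun h => (ihS h).concat (ht.of_weight_eq hqt hW)⟩

/-- The state `(v, σ)` improves into `(t, τ)` if some walk from `v` to `t` leads both from weight
`σ` and from some strictly larger path weight at `v` to the weight `τ`. -/
def ImprovesInto (A : V → V → Prop) (s : V) (W : List V → S) (x y : V × S) : Prop :=
  ∃ p r, IsStPath A s x.1 p ∧ r ≠ [] ∧ IsStPath A x.1 y.1 (x.1 :: r) ∧ x.2 < W p ∧
    W (p ++ r) = y.2 ∧ ∀ q, IsStPath A s x.1 q → W q = x.2 → W (q ++ r) = y.2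

theorem ImprovesInto.trans {x y z : V × S} (hxy : ImprovesInto A s W x y)
    (hyz : ImprovesInto A s W y z) : ImprovesInto A s W x z := by
  obtain ⟨p, r, hp, hr0, hr, hlt, hpr, hall⟩ := hxy
  obtain ⟨-, l, -, -, hl, -, -, hall'⟩ := hyz
  refine ⟨p, r ++ l, hp, by simp [hr0], hr.append hl, hlt, ?_, fun q hq hqx => ?_⟩
  · rw [← List.append_assoc]
    exact hall' _ (hp.append hr) hpr
  · rw [← List.append_assoc]
    exact hall' _ (hq.append hr) (hall q hq hqx)

theorem CycleNonDecreasing.not_improvesInto_self (hCND : CycleNonDecreasing A s W) (x : V × S) :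
    ¬ ImprovesInto A s W x x := by
  rintro ⟨p, r, hp, hr0, hr, hlt, hpr, -⟩
  refine hCND x.1 p (x.1 :: r) hp hr ?_ (by simpa [hpr] using hlt)
  simpa [Nat.one_le_iff_ne_zero] using hr0

theorem WellPosed.finite_states [Finite V] (hWP : WellPosed A s W) :
    {x : V × S | x.2 ∈ NondomSet A s W x.1}.Finite :=
  (Set.finite_univ.prod hWP.1).subset fun x hx => ⟨trivial, Set.mem_iUnion.2 ⟨x.1, hx⟩⟩

end Paths

/-- A well-posed, history-free, weakly independent and
cycle-non-decreasing POSP instance is weakly subpath optimal. -/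
theorem wp_hf_wi_cnd_implies_wso
    {V S : Type*} [Fintype V] [Nonempty V] [PartialOrder S]
    (A : V → V → Prop) (s : V) (W : List V → S)
    (hWP : WellPosed A s W) (hHF : HistoryFree A s W)
    (hWI : WeaklyIndependent A s W) (hCND : CycleNonDecreasing A s W) :
    WeaklySubpathOptimal A s W := by
  have hfin := hWP.finite_states
  have : IsStrictOrder (V × S) (ImprovesInto A s W) :=
    { irrefl := hCND.not_improvesInto_self
      trans := fun _ _ _ => ImprovesInto.trans }
  have key : ∀ x ∈ {x : V × S | x.2 ∈ NondomSet A s W x.1},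
      ∃ q, IsStPath A s x.1 q ∧ W q = x.2 ∧ SubpathOptimalPath A s W q := by
    intro x hx
    refine (hfin.wellFoundedOn (r := ImprovesInto A s W)).induction
      (P := fun x => ∃ q, IsStPath A s x.1 q ∧ W q = x.2 ∧ SubpathOptimalPath A s W q) hx ?_
    rintro ⟨t, τ⟩ ⟨p, hp, rfl⟩ ih
    rcases hp.1.subpathOptimal_or_exists_split (efficientPath_singleton hCND) with
      h | ⟨q, r, v, rfl, hq, hne, hr⟩
    · exact ⟨p, hp.1, rfl, h⟩
    · have hr0 : r ≠ [] := by
        rintro rfl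
        obtain rfl : v = t := by
          simpa [hq.2.2] using hp.1.2.2
        exact hne (by simpa using hp)
      have hvt := hp.1.of_append hq
      obtain ⟨q', hq', hle⟩ := hWP.exists_efficientPath_le hq
      have hlt : W q' < W q :=
        hle.lt_of_ne fun h => hne (hq'.of_weight_eq hq h.symm)
      obtain ⟨o, ho, hoW, hoS⟩ := ih (v, W q') ⟨q', hq', rfl⟩
        ⟨q, r, hq, hr0, hvt, hlt, rfl, fun l hl hlW =>
          (weight_append_eq_of_lt hHF hWI hq hl (by simpa [hlW] using hlt) hr).1 hr0⟩
      have h := weight_append_eq_of_lt hHF hWI hq ho (by simpa [hoW] using hlt) hr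
      exact ⟨o ++ r, ho.append hvt, h.1 hr0, h.2 hoS⟩
  intro t p hp
  exact key (t, W p) ⟨p, hp, rfl⟩
end

section
/- Let (G,W,S,⪯,s) be a POSP instance that is well-posed, weakly subpath optimal and history-free with arc update function U : S × A → S (i.e., W(p+a) = U(W(p),a) for every path p ∈ P_s ending at some v and every arc a out of v). Define sets D_{v,k} ⊆ S by D_{s,0} = {W((s))}, D_{v,0} = ∅ for v ≠ s, and D_{v,k} = Min(D_{v,k−1} ∪ {U(τ,(u,v)) : (u,v) ∈ A, τ ∈ D_{u,k−1}}) for k ≥ 1, where Min(T) := {τ ∈ T : there is no σ ∈ T with σ ≺ τ}. Then there exists K ∈ ℕ such that for all k ≥ K and all v ∈ V, D_{v,k} = N_{s,v}. (Correctness of the Bellman–Ford-type label-correcting algorithm for POSP under weak subpath optimality, at the level of weight sets.) -/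
/-- `Min(T)`: the elements of `T` not strictly dominated by any element of `T`. -/
def MinSet {S : Type*} [PartialOrder S] (T : Set S) : Set S :=
  {τ | τ ∈ T ∧ ¬ ∃ σ ∈ T, σ < τ}

/-- The weights of the `s,v`-paths. -/
def stPathWeights {V S : Type*} (A : V → V → Prop) (s : V) (W : List V → S) (v : V) : Set S :=
  {τ | ∃ p : List V, IsStPath A s v p ∧ W p = τ}

theorem IsStPath.append_singleton {V : Type*} {A : V → V → Prop} {s v u : V} {p : List V}
    (hp : IsStPath A s v p) (h : A v u) : IsStPath A s u (p ++ [u]) := by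
  obtain ⟨⟨hne, hc⟩, hs, hv⟩ := hp
  refine ⟨⟨by simp, ?_⟩, ?_, by simp⟩
  · refine List.IsChain.append hc (List.isChain_singleton u) ?_
    intro x hx y hy
    rw [hv] at hx
    simp only [Option.mem_def, Option.some.injEq, List.head?_cons] at hx hy
    subst hx hy
    exact h
  · rw [List.head?_append, hs]
    rfl

theorem mem_nondomSet_iff {V S : Type*} [PartialOrder S] {A : V → V → Prop} {s : V}
    {W : List V → S} {v : V} {τ : S} :
    τ ∈ NondomSet A s W v ↔
      τ ∈ stPathWeights A s W v ∧ ∀ σ ∈ stPathWeights A s W v, ¬ σ < τ := by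
  constructor
  · rintro ⟨p, ⟨hp, hmin⟩, rfl⟩
    refine ⟨⟨p, hp, rfl⟩, ?_⟩
    rintro _ ⟨q, hq, rfl⟩
    exact hmin q hq
  · rintro ⟨⟨p, hp, rfl⟩, hmin⟩
    exact ⟨p, ⟨hp, fun q hq => hmin _ ⟨q, hq, rfl⟩⟩, rfl⟩

/-- In a well-posed instance every path weight is dominated by a nondominated one. -/
theorem WellPosed.exists_nondom_le {V S : Type*} [PartialOrder S] {A : V → V → Prop} {s : V}
    {W : List V → S} (hWP : WellPosed A s W) {v : V} {τ : S} (hτ : τ ∈ stPathWeights A s W v) :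
    ∃ σ ∈ NondomSet A s W v, σ ≤ τ := by
  obtain ⟨m, hm, hmax⟩ := zorn_le_nonempty₀ (α := Sᵒᵈ)
    (OrderDual.ofDual ⁻¹' stPathWeights A s W v) (by
      intro C hC hchain y hy
      obtain ⟨m, hm, hle⟩ := hWP.2 (OrderDual.toDual ⁻¹' C)
        (by
          intro x hx
          obtain ⟨p, hp, hpx⟩ := hC hx
          exact ⟨p, hp.1, hp.2.1, hpx⟩)
        (fun a ha b hb hab => (hchain ha hb hab).symm) ⟨OrderDual.ofDual y, hy⟩
      exact ⟨OrderDual.toDual m, hC hm, fun z hz => hle _ hz⟩)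
    (OrderDual.toDual τ) hτ
  refine ⟨OrderDual.ofDual m, mem_nondomSet_iff.2 ⟨hmax.prop, fun σ hσ hlt => ?_⟩, hm⟩
  exact hlt.not_ge (hmax.2 (y := OrderDual.toDual σ) hσ hlt.le)

/-- Correctness of the Bellman–Ford-type label-correcting algorithm
for well-posed, history-free (with arc update function `U`) and weakly subpath
optimal POSP instances, at the level of weight sets: the iterates `D k v` eventually
equal the nondominated sets `N_{s,v}`. -/
theorem bellmanFord_correct_weaklySubpathOptimal
    {V S : Type*} [Fintype V] [Nonempty V] [PartialOrder S]
    (A : V → V → Prop) (s : V) (W : List V → S)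
    (hWP : WellPosed A s W) (hWSO : WeaklySubpathOptimal A s W)
    (U : S → V → V → S)
    (hU : ∀ v u : V, A v u → ∀ p : List V, IsStPath A s v p →
      W (p ++ [u]) = U (W p) v u)
    (D : ℕ → V → Set S)
    (hD0s : D 0 s = {W [s]})
    (hD0 : ∀ v : V, v ≠ s → D 0 v = ∅)
    (hDk : ∀ (k : ℕ) (v : V),
      D (k + 1) v =
        MinSet (D k v ∪ {σ | ∃ u : V, A u v ∧ ∃ τ ∈ D k u, σ = U τ u v})) :
    ∃ K : ℕ, ∀ k ≥ K, ∀ v : V, D k v = NondomSet A s W v := by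
  have hsub : ∀ k v, D k v ⊆ stPathWeights A s W v := by
    intro k
    induction k with
    | zero =>
      intro v x hx
      by_cases hv : v = s
      · subst hv
        rw [hD0s] at hx
        exact ⟨[v], ⟨⟨by simp, List.isChain_singleton v⟩, rfl, rfl⟩, hx.symm⟩
      · rw [hD0 v hv] at hx
        exact hx.elim
    | succ k ih =>
      intro v x hx
      rw [hDk] at hx
      rcases hx.1 with hx | ⟨u, hA, τ, hτ, rfl⟩
      · exact ih v hx
      · obtain ⟨p, hp, rfl⟩ := ih u hτ
        exact ⟨p ++ [v], hp.append_singleton hA, hU u v hA p hp⟩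
  have hstep : ∀ k v τ, τ ∈ NondomSet A s W v →
      τ ∈ D k v ∪ {σ | ∃ u : V, A u v ∧ ∃ τ ∈ D k u, σ = U τ u v} → τ ∈ D (k + 1) v := by
    intro k v τ hN hτ
    rw [hDk]
    refine ⟨hτ, ?_⟩
    rintro ⟨σ, hσ, hlt⟩
    refine (mem_nondomSet_iff.1 hN).2 σ ?_ hlt
    rcases hσ with hσ | ⟨u, hA, ρ, hρ, rfl⟩
    · exact hsub k v hσ
    · obtain ⟨p, hp, rfl⟩ := hsub k u hρ
      exact ⟨p ++ [v], hp.append_singleton hA, hU u v hA p hp⟩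
  have hpersist : ∀ v τ, τ ∈ NondomSet A s W v → ∀ k, τ ∈ D k v → ∀ l ≥ k, τ ∈ D l v := by
    intro v τ hN k hk l hl
    induction l, hl using Nat.le_induction with
    | base => exact hk
    | succ l _ ih => exact hstep l v τ hN (Or.inl ih)
  have hprefix : ∀ q : List V, IsPath A q → SubpathOptimalPath A s W q →
      ∀ (i : ℕ) (h : i < q.length), W (q.take (i + 1)) ∈ D i q[i] := by
    intro q hq hopt i
    induction i with
    | zero =>
      intro h
      have h1 := (hopt 0 h).1.2.1
      obtain ⟨a, l, rfl⟩ := List.exists_cons_of_length_pos h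
      obtain rfl : a = s := by simpa using h1
      simp [hD0s]
    | succ i ih =>
      intro h
      have hi : i < q.length := by omega
      have hA : A q[i] q[i + 1] := List.isChain_iff_getElem.1 hq.2 i h
      refine hstep i _ _ ⟨_, hopt (i + 1) h, rfl⟩ (Or.inr ⟨q[i], hA, _, ih hi, ?_⟩)
      rw [← hU _ _ hA _ (hopt i hi).1, List.take_append_getElem h]
  have hreach : ∀ v, ∀ τ ∈ NondomSet A s W v, ∃ k, τ ∈ D k v := by
    rintro v _ ⟨p, hp, rfl⟩
    obtain ⟨q, hq, hqp, hopt⟩ := hWSO v p hp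
    have hlen : 0 < q.length := List.length_pos_iff.2 hq.1.1
    have hlast : q[q.length - 1]'(by omega) = v := by
      have := hq.2.2
      rw [List.getLast?_eq_getElem?, List.getElem?_eq_getElem (by omega)] at this
      exact Option.some.inj this
    have h := hprefix q hq.1 hopt (q.length - 1) (by omega)
    rw [hlast, Nat.sub_add_cancel hlen, List.take_length, hqp] at h
    exact ⟨_, h⟩
  have hfin : ∀ᶠ k in Filter.atTop, ∀ v, ∀ τ ∈ NondomSet A s W v, τ ∈ D k v := by
    rw [Filter.eventually_all]
    intro v
    rw [Filter.eventually_all_finite (hWP.1.subset (Set.subset_iUnion _ v))]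
    intro τ hτ
    obtain ⟨k, hk⟩ := hreach v τ hτ
    exact Filter.eventually_atTop.2 ⟨k, hpersist v τ hτ k hk⟩
  obtain ⟨K, hK⟩ := Filter.eventually_atTop.1 hfin
  refine ⟨K + 1, fun k hk v => Set.Subset.antisymm (fun x hx => ?_) (hK k (by omega) v)⟩
  obtain ⟨σ, hσ, hle⟩ := hWP.exists_nondom_le (hsub k v hx)
  obtain ⟨l, rfl⟩ : ∃ l, k = l + 1 := ⟨k - 1, by omega⟩
  rw [hDk] at hx
  rcases hle.eq_or_lt with rfl | hlt
  · exact hσ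
  · exact (hx.2 ⟨σ, Or.inl (hK l (by omega) v σ hσ), hlt⟩).elim
end
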